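/- Assume N is even, N ≥ 6, and ⟨L_{N−1},L_{N−2}⟩₁·⟨L_{N−3},L_{N−4}⟩₁ ≠ 0. For 0 ≤ j ≤ N−3 let r_j be arbitrary monic polynomials of degree j, and set r_{N−2} = π_{N−2,1}, r_{N−1} = π_{N−1,1}, the monic skew-orthogonal polynomials (with π_{N−1,1} taken with c = 0 in its explicit Laguerre expansion). Then the N×N matrix D with entries D_{jk} = ⟨r_j, r_k⟩₁ (0 ≤ j,k ≤ N−1) is invertible, and, writing μ = D^{−1} and S₁(x,y) = −Σ_{j,k=0}^{N−1} r_j(x)·w(x)·μ_{jk}·ε(r_k w)(y), for all x, y ∈ (0,∞): S₁(x,y) − K₂(x,y) = ε(π_{N+1,1}w)(y)·(−M/(2h_{N−1,0}))·L_{N−1}(x)·w(x) + ε(π_{N,1}w)(y)·[(−M/(2h_{N−2,0}))·L_{N−2}(x) + ((Mt−(M+N))/(2h_{N−1,0}))·L_{N−1}(x)]·w(x), where K₂(x,y) = w(x)·w(y)·y·(t−y)·(L_N(x)L_{N−1}(y) − L_N(y)L_{N−1}(x))/(h_{N−1,0}·(x−y)) is the Christoffel–Darboux kernel of the Laguerre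 polynomials (with the square roots resolved so that the stated product formula holds). -/

import Mathlib

open MeasureTheory Polynomial Set

noncomputable section

/-- The weight `w(x) = e^{−Mx/2}·x^{(M−N−1)/2}·(t−x)^{−1/2}` on `(0,∞)`,
using the principal branch of the complex power. -/
def wC (M N : ℕ) (t : ℂ) (x : ℝ) : ℂ :=
  Complex.exp (-(M : ℂ) * x / 2) * (x : ℂ) ^ (((((M : ℝ) - N - 1) / 2 : ℝ)) : ℂ) *
    (t - x) ^ (-(1 / 2) : ℂ)

/-- The Laguerre weight `w₀(x) = x^{M−N}·e^{−Mx}`. -/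
def w0R (M N : ℕ) (x : ℝ) : ℝ := x ^ (M - N) * Real.exp (-(M : ℝ) * x)

/-- The skew product `⟨f,g⟩₁ = ∫₀^∞∫₀^∞ (1/2)·sgn(x−y)·f(x)·g(y)·w(x)·w(y) dy dx`. -/
def skew1 (M N : ℕ) (t : ℂ) (f g : Polynomial ℂ) : ℂ :=
  ∫ x in Ioi (0 : ℝ), ∫ y in Ioi (0 : ℝ),
    ((Real.sign (x - y) : ℝ) : ℂ) / 2 * f.eval (x : ℂ) * g.eval (y : ℂ) *
      wC M N t x * wC M N t y

/-- The inner product `⟨f,g⟩₂ = ∫₀^∞ f(x)·g(x)·w₀(x) dx`. -/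
def inner2C (M N : ℕ) (f g : Polynomial ℂ) : ℂ :=
  ∫ x in Ioi (0 : ℝ), f.eval (x : ℂ) * g.eval (x : ℂ) * (w0R M N x : ℂ)

/-- `IsLag M N L` says that `L n` is the monic degree-`n` orthogonal polynomial for the
weight `w₀` (the rescaled Laguerre polynomial). -/
def IsLag (M N : ℕ) (L : ℕ → Polynomial ℂ) : Prop :=
  ∀ n, (L n).Monic ∧ (L n).natDegree = n ∧
    ∀ j, j < n → inner2C M N (L n) (Polynomial.X ^ j) = 0

/-- The operator `T(q)(x) = x(t−x)q′(x) +
[(t−2x) − (M/2)x(t−x) + ((M−N−1)/2)(t−x) + x/2]·q(x)`,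
i.e. formally `T(q) = (d/dx)(q·x·(t−x)·w)/w`. -/
def Tq (M N : ℕ) (t : ℂ) (q : Polynomial ℂ) : Polynomial ℂ :=
  Polynomial.X * (Polynomial.C t - Polynomial.X) * Polynomial.derivative q +
    ((Polynomial.C t - 2 * Polynomial.X)
        - Polynomial.C ((M : ℂ) / 2) * (Polynomial.X * (Polynomial.C t - Polynomial.X))
        + Polynomial.C (((M : ℂ) - N - 1) / 2) * (Polynomial.C t - Polynomial.X)
        + Polynomial.C (1 / 2) * Polynomial.X) * q

/-- `ε(f)(x) = ∫₀^∞ (1/2)·sgn(x−y)·f(y) dy`. -/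
def epsC (f : ℝ → ℂ) (x : ℝ) : ℂ :=
  ∫ y in Ioi (0 : ℝ), ((Real.sign (x - y) : ℝ) : ℂ) / 2 * f y

/-- The squared norm `h_{n,0} = ∫₀^∞ L_n(x)²·w₀(x) dx`. -/
def hC (M N : ℕ) (L : ℕ → Polynomial ℂ) (n : ℕ) : ℂ :=
  ∫ x in Ioi (0 : ℝ), (L n).eval (x : ℂ) ^ 2 * (w0R M N x : ℂ)

end

/-- A polynomial times a function dominated by `x ^ s * exp (-b * x)` is integrable on `(0,∞)`. -/
lemma integrableOn_eval_mul_of_norm_le {v : ℝ → ℂ} {C s b : ℝ} (hs : 0 ≤ s) (hb : 0 < b)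
    (hv : ContinuousOn v (Ioi 0))
    (hbd : ∀ x ∈ Ioi (0 : ℝ), ‖v x‖ ≤ C * (x ^ s * Real.exp (-b * x)))
    (p : ℂ[X]) : IntegrableOn (fun x : ℝ => p.eval (x : ℂ) * v x) (Ioi 0) := by
  induction p using Polynomial.induction_on' with
  | add p q hp hq =>
    simp only [eval_add, add_mul]
    exact hp.add hq
  | monomial n a =>
    have h0 : IntegrableOn (fun x : ℝ => ‖a‖ * C * (x ^ ((n : ℝ) + s) * Real.exp (-b * x)))
        (Ioi 0) := by
      have := integrableOn_rpow_mul_exp_neg_mul_rpow (p := 1) (s := n + s) (b := b)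
        (by have : (0 : ℝ) ≤ n := n.cast_nonneg; linarith) one_pos hb
      simp only [Real.rpow_one] at this
      exact this.const_mul _
    refine Integrable.mono' h0 ?_ ?_
    · refine ContinuousOn.aestronglyMeasurable ?_ measurableSet_Ioi
      refine ContinuousOn.mul ?_ hv
      exact (by fun_prop : Continuous fun x : ℝ => (monomial n a).eval (x : ℂ)).continuousOn
    · filter_upwards [ae_restrict_mem measurableSet_Ioi] with x hx
      have hx' : (0 : ℝ) < x := hx
      rw [Real.rpow_add hx', Real.rpow_natCast]
      simp only [eval_monomial, norm_mul, norm_pow, Complex.norm_real, Real.norm_eq_abs,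
        abs_of_pos hx']
      calc _ ≤ ‖a‖ * x ^ n * (C * (x ^ s * Real.exp (-b * x))) := by
            gcongr; exact hbd x hx
        _ = _ := by ring

/-- If `F` and `F'` are integrable on `(0,∞)` and `F` vanishes at `0`, then `F'` has integral
`-F y` over `(y,∞)` and `F y` over `(0,y)`, so that `ε(F') = F`. -/
lemma epsC_deriv {F F' : ℝ → ℂ} (hd : ∀ x ∈ Ioi (0 : ℝ), HasDerivAt F (F' x) x)
    (hF : IntegrableOn F (Ioi 0)) (hF' : IntegrableOn F' (Ioi 0))
    (h0 : Filter.Tendsto F (nhdsWithin 0 (Ioi 0)) (nhds 0)) {y : ℝ} (hy : 0 < y) :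
    epsC F' y = F y := by
  have htop := tendsto_zero_of_hasDerivAt_of_integrableOn_Ioi hd hF' hF
  have h2 : ∫ x in Ioi y, F' x = 0 - F y :=
    integral_Ioi_of_hasDerivAt_of_tendsto' (fun x hx => hd x (lt_of_lt_of_le hy hx))
      (hF'.mono_set (Ioi_subset_Ioi hy.le)) htop
  have h1 : ∫ x in (0 : ℝ)..y, F' x = F y - 0 :=
    intervalIntegral.integral_eq_sub_of_hasDerivAt_of_tendsto hy (fun x hx => hd x hx.1)
      ((intervalIntegrable_iff_integrableOn_Ioc_of_le hy.le).2 (hF'.mono_set Ioc_subset_Ioi_self)) h0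
      ((hd y hy).continuousAt.tendsto.mono_left nhdsWithin_le_nhds)
  rw [intervalIntegral.integral_of_le hy.le, integral_Ioc_eq_integral_Ioo] at h1
  have e1 : ∫ x in Ioo 0 y, ((Real.sign (y - x) : ℝ) : ℂ) / 2 * F' x = 1 / 2 * F y := by
    rw [← sub_zero (F y), ← h1, ← integral_const_mul]
    refine setIntegral_congr_fun measurableSet_Ioo fun x hx => ?_
    simp [Real.sign_of_pos (sub_pos.2 hx.2)]
  have e2 : ∫ x in Ioi y, ((Real.sign (y - x) : ℝ) : ℂ) / 2 * F' x = 1 / 2 * F y := by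
    rw [show 1 / 2 * F y = (-1 / 2) * (0 - F y) by ring, ← h2, ← integral_const_mul]
    refine setIntegral_congr_fun measurableSet_Ioi fun x hx => ?_
    simp [Real.sign_of_neg (sub_neg.2 hx)]
  have i1 : IntegrableOn (fun x => ((Real.sign (y - x) : ℝ) : ℂ) / 2 * F' x) (Ioo 0 y) :=
    IntegrableOn.congr_fun ((hF'.mono_set Ioo_subset_Ioi_self).const_mul (1 / 2)) (fun x hx => by
      simp [Real.sign_of_pos (sub_pos.2 hx.2)]) measurableSet_Ioo
  have i2 : IntegrableOn (fun x => ((Real.sign (y - x) : ℝ) : ℂ) / 2 * F' x) (Ioi y) :=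
    IntegrableOn.congr_fun ((hF'.mono_set (Ioi_subset_Ioi hy.le)).const_mul (-1 / 2)) (fun x hx => by
      simp [Real.sign_of_neg (sub_neg.2 hx)]) measurableSet_Ioi
  rw [epsC, ← Ioc_union_Ioi_eq_Ioi hy.le, setIntegral_union Ioc_disjoint_Ioi_same
    measurableSet_Ioi (integrableOn_Ioc_iff_integrableOn_Ioo (by simp) |>.2 i1) i2,
    integral_Ioc_eq_integral_Ioo, e1, e2]
  ring

section Weight

variable {M N : ℕ} {t : ℂ}

lemma sub_ofReal_mem_slitPlane (ht : t.im ≠ 0) (x : ℝ) : t - x ∈ Complex.slitPlane :=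
  Or.inr (by simpa using ht)

lemma sub_ofReal_ne_zero (ht : t.im ≠ 0) (x : ℝ) : t - x ≠ 0 :=
  Complex.slitPlane_ne_zero (sub_ofReal_mem_slitPlane ht x)

lemma wC_sq (hNM : N < M) (ht : t.im ≠ 0) {x : ℝ} (hx : 0 < x) :
    wC M N t x * wC M N t x * (x * (t - x)) = (w0R M N x : ℂ) := by
  have h1 := sub_ofReal_ne_zero ht x
  have hx' : (x : ℂ) ≠ 0 := by exact_mod_cast hx.ne'
  have e1 : (t - x) ^ (-(1 / 2) : ℂ) * (t - x) ^ (-(1 / 2) : ℂ) * (t - x) = 1 := by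
    rw [← Complex.cpow_add _ _ h1]
    norm_num [Complex.cpow_neg_one, h1]
  have e2 : (x : ℂ) ^ (((((M : ℝ) - N - 1) / 2 : ℝ)) : ℂ) *
      (x : ℂ) ^ (((((M : ℝ) - N - 1) / 2 : ℝ)) : ℂ) * x = (x : ℂ) ^ (M - N) := by
    nth_rewrite 3 [← Complex.cpow_one (x : ℂ)]
    rw [← Complex.cpow_add _ _ hx', ← Complex.cpow_add _ _ hx', ← Complex.cpow_natCast]
    congr 1
    push_cast [Nat.cast_sub hNM.le]
    ring
  have e3 : Complex.exp (-(M : ℂ) * x / 2) * Complex.exp (-(M : ℂ) * x / 2)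
      = Complex.exp (-(M : ℂ) * x) := by
    rw [← Complex.exp_add]; ring_nf
  rw [wC, w0R, Complex.ofReal_mul, Complex.ofReal_pow, Complex.ofReal_exp, Complex.ofReal_mul,
    Complex.ofReal_neg, Complex.ofReal_natCast, ← e2, ← e3]
  linear_combination (Complex.exp (-(M : ℂ) * x / 2) * Complex.exp (-(M : ℂ) * x / 2) *
    ((x : ℂ) ^ (((((M : ℝ) - N - 1) / 2 : ℝ)) : ℂ) *
      (x : ℂ) ^ (((((M : ℝ) - N - 1) / 2 : ℝ)) : ℂ) * x)) * e1

lemma hasDerivAt_wC (ht : t.im ≠ 0) {x : ℝ} (hx : 0 < x) :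
    HasDerivAt (wC M N t)
      ((-(M : ℂ) / 2 + ((M : ℂ) - N - 1) / 2 / x + 1 / 2 / (t - x)) * wC M N t x) x := by
  have h1 := sub_ofReal_ne_zero ht x
  have hx' : (x : ℂ) ≠ 0 := by exact_mod_cast hx.ne'
  have hs : (x : ℂ) ∈ Complex.slitPlane := by simp [Complex.slitPlane, hx]
  have d1 : HasDerivAt (fun z : ℂ => Complex.exp (-(M : ℂ) * z / 2))
      (Complex.exp (-(M : ℂ) * x / 2) * (-(M : ℂ) * 1 / 2)) x :=
    (((hasDerivAt_id (x : ℂ)).const_mul _).div_const 2).cexp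
  have d2 := (hasDerivAt_id (x : ℂ)).cpow_const (c := ((((M : ℝ) - N - 1) / 2 : ℝ) : ℂ)) hs
  have d3 := ((hasDerivAt_id (x : ℂ)).const_sub t).cpow_const (c := (-(1 / 2) : ℂ))
    (sub_ofReal_mem_slitPlane ht x)
  have := ((d1.mul d2).mul d3).comp_ofReal
  refine HasDerivAt.congr_deriv (f := wC M N t) this ?_
  simp only [wC, id, Pi.mul_apply, Complex.cpow_sub _ _ hx', Complex.cpow_sub _ _ h1,
    Complex.cpow_one]
  generalize Complex.exp (-(M : ℂ) * x / 2) = a, (t - (x : ℂ)) ^ (-(1 / 2) : ℂ) = b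
  rw [show ((((M : ℝ) - N - 1) / 2 : ℝ) : ℂ) = ((M : ℂ) - N - 1) / 2 by push_cast; rfl]
  generalize (x : ℂ) ^ (((M : ℂ) - N - 1) / 2) = c
  field_simp

lemma continuousOn_wC (ht : t.im ≠ 0) : ContinuousOn (wC M N t) (Ioi 0) := fun _ hx =>
  (hasDerivAt_wC ht hx).continuousAt.continuousWithinAt

lemma norm_wC_le (ht : t.im ≠ 0) {x : ℝ} (hx : 0 < x) :
    ‖wC M N t x‖ ≤ |t.im| ^ (-(1 / 2) : ℝ) *
      (x ^ (((M : ℝ) - N - 1) / 2) * Real.exp (-(M / 2 : ℝ) * x)) := by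
  have h3 : ‖(t - x) ^ (-(1 / 2) : ℂ)‖ ≤ |t.im| ^ (-(1 / 2) : ℝ) := by
    have := Complex.norm_cpow_real (t - x) (-(1 / 2) : ℝ)
    push_cast at this
    rw [this]
    refine Real.rpow_le_rpow_of_nonpos (abs_pos.2 ht) ?_ (by norm_num)
    simpa using Complex.abs_im_le_norm (t - x)
  have h1 : ‖Complex.exp (-(M : ℂ) * x / 2)‖ = Real.exp (-(M / 2 : ℝ) * x) := by
    rw [Complex.norm_exp]
    congr 1
    have : (-(M : ℂ) * x / 2) = ((-(M / 2 : ℝ) * x : ℝ) : ℂ) := by push_cast; ring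
    rw [this, Complex.ofReal_re]
  rw [wC, norm_mul, norm_mul, Complex.norm_cpow_real, Complex.norm_real, Real.norm_eq_abs,
    abs_of_pos hx, h1, mul_comm]
  gcongr ?_ * ?_
  rw [mul_comm]

lemma exponent_nonneg (hNM : N < M) : 0 ≤ ((M : ℝ) - N - 1) / 2 := by
  have : (N : ℝ) + 1 ≤ M := by exact_mod_cast hNM
  linarith

lemma integrableOn_eval_mul_wC (hNM : N < M) (ht : t.im ≠ 0) (p : ℂ[X]) :
    IntegrableOn (fun x : ℝ => p.eval (x : ℂ) * wC M N t x) (Ioi 0) :=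
  integrableOn_eval_mul_of_norm_le (exponent_nonneg hNM)
    (by have : (0 : ℝ) < M := by exact_mod_cast (Nat.zero_le N).trans_lt hNM
        positivity) (continuousOn_wC ht) (fun _ hx => norm_wC_le ht hx) p

lemma integrableOn_eval_mul_w0R (hNM : N < M) (p : ℂ[X]) :
    IntegrableOn (fun x : ℝ => p.eval (x : ℂ) * (w0R M N x : ℂ)) (Ioi 0) := by
  refine integrableOn_eval_mul_of_norm_le (C := 1) (s := ((M - N : ℕ) : ℝ)) (b := M)
    (Nat.cast_nonneg _) (by exact_mod_cast (Nat.zero_le N).trans_lt hNM) ?_ ?_ p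
  · unfold w0R
    fun_prop
  · intro x hx
    have hx' : (0 : ℝ) < x := hx
    rw [Complex.norm_real, Real.norm_eq_abs, w0R, abs_of_pos (by positivity), one_mul,
      Real.rpow_natCast]

/-- Integration by parts: `ε(T(q)·w)(y) = y(t−y)q(y)w(y)`. -/
lemma epsC_Tq (hNM : N < M) (ht : t.im ≠ 0) (q : ℂ[X]) {y : ℝ} (hy : 0 < y) :
    epsC (fun x => (Tq M N t q).eval (x : ℂ) * wC M N t x) y
      = q.eval (y : ℂ) * (y * (t - y)) * wC M N t y := by
  have key := epsC_deriv (F := fun x : ℝ => (X * (C t - X) * q).eval (x : ℂ) * wC M N t x)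
    (F' := fun x => (Tq M N t q).eval (x : ℂ) * wC M N t x) ?_
    (integrableOn_eval_mul_wC hNM ht _) (integrableOn_eval_mul_wC hNM ht _) ?_ hy
  · rw [key]
    simp only [eval_mul, eval_X, eval_sub, eval_C]
    ring
  · intro x hx
    have h1 := sub_ofReal_ne_zero ht x
    have hx' : (x : ℂ) ≠ 0 := by exact_mod_cast (ne_of_gt hx)
    have d := ((X * (C t - X) * q).hasDerivAt (x : ℂ)).comp_ofReal.mul
      (hasDerivAt_wC (M := M) (N := N) ht hx)
    refine d.congr_deriv ?_
    simp [Tq]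
    field_simp
    ring
  · have hp : Filter.Tendsto (fun x : ℝ => (X * (C t - X) * q).eval (x : ℂ))
        (nhdsWithin 0 (Ioi 0)) (nhds 0) := by
      have : Continuous fun x : ℝ => (X * (C t - X) * q).eval (x : ℂ) := by fun_prop
      simpa using (this.tendsto 0).mono_left nhdsWithin_le_nhds
    refine hp.zero_mul_isBoundedUnder_le ?_
    refine Filter.isBoundedUnder_of_eventually_le (a := |t.im| ^ (-(1 / 2) : ℝ)) ?_
    filter_upwards [Ioo_mem_nhdsGT (zero_lt_one' ℝ)] with x hx
    refine (norm_wC_le ht hx.1).trans (mul_le_of_le_one_right (by positivity) ?_)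
    refine mul_le_one₀ (Real.rpow_le_one hx.1.le hx.2.le (exponent_nonneg hNM)) (by positivity) ?_
    have := hx.1
    rw [Real.exp_le_one_iff]
    have : (0:ℝ) ≤ M / 2 * x := by positivity
    linarith

/-- The total derivative of `x·q(x)·w₀(x)` integrates to zero. -/
lemma integral_deriv_w0R (hNM : N < M) (q : ℂ[X]) :
    ∫ x in Ioi (0 : ℝ), (X * derivative q + (C ((M : ℂ) - N + 1) - C (M : ℂ) * X) * q).eval (x : ℂ)
      * (w0R M N x : ℂ) = 0 := by
  have hd : ∀ x : ℝ, HasDerivAt (fun x : ℝ => (X * q).eval (x : ℂ) * (w0R M N x : ℂ))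
      ((X * derivative q + (C ((M : ℂ) - N + 1) - C (M : ℂ) * X) * q).eval (x : ℂ)
        * (w0R M N x : ℂ)) x := by
    intro x
    have dw : HasDerivAt (fun z : ℂ => z ^ (M - N) * Complex.exp (-(M : ℂ) * z))
        ((M - N : ℕ) * (x : ℂ) ^ (M - N - 1) * Complex.exp (-(M : ℂ) * x) +
          (x : ℂ) ^ (M - N) * (Complex.exp (-(M : ℂ) * x) * (-(M : ℂ) * 1))) x :=
      (hasDerivAt_pow _ _).mul ((hasDerivAt_id (x : ℂ)).const_mul _).cexp
    have d := (((X * q).hasDerivAt (x : ℂ)).mul dw).comp_ofReal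
    obtain ⟨k, hk⟩ : ∃ k, M - N = k + 1 := ⟨M - N - 1, by omega⟩
    have hk' : (M : ℂ) - N = k + 1 := by
      rw [← Nat.cast_sub hNM.le, hk]; push_cast; ring
    convert d using 1
    · ext z; simp [w0R]
    · simp [w0R, hk, hk']
      ring
  have h := integral_Ioi_of_hasDerivAt_of_tendsto' (a := (0 : ℝ)) (fun x _ => hd x)
    (integrableOn_eval_mul_w0R hNM _)
    (tendsto_zero_of_hasDerivAt_of_integrableOn_Ioi (a := (0 : ℝ)) (fun x _ => hd x)
      (integrableOn_eval_mul_w0R hNM _) (integrableOn_eval_mul_w0R hNM _))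
  rw [h]
  simp

end Weight

section Forms

variable {M N : ℕ} {t : ℂ}

lemma measurable_sign_sub : Measurable fun z : ℝ × ℝ => Real.sign (z.1 - z.2) := by
  have : Measurable Real.sign := by
    unfold Real.sign
    exact Measurable.ite measurableSet_Iio measurable_const
      (Measurable.ite measurableSet_Ioi measurable_const measurable_const)
  exact this.comp (measurable_fst.sub measurable_snd)

lemma norm_sign_div_two_le (x : ℝ) : ‖((Real.sign x : ℝ) : ℂ) / 2‖ ≤ 1 := by
  rcases Real.sign_apply_eq x with h | h | h <;> rw [h] <;> norm_num

lemma integrable_sign_mul_mul {f g : ℝ → ℂ} (hf : IntegrableOn f (Ioi 0))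
    (hg : IntegrableOn g (Ioi 0)) :
    Integrable (fun z : ℝ × ℝ => ((Real.sign (z.1 - z.2) : ℝ) : ℂ) / 2 * (f z.1 * g z.2))
      ((volume.restrict (Ioi 0)).prod (volume.restrict (Ioi 0))) := by
  refine (Integrable.mul_prod hf hg).bdd_mul (c := 1) ?_ ?_
  · exact ((Complex.measurable_ofReal.comp measurable_sign_sub).div_const 2).aestronglyMeasurable
  · exact Filter.Eventually.of_forall fun z => norm_sign_div_two_le _

lemma integrableOn_sign_mul {f : ℝ → ℂ} (hf : IntegrableOn f (Ioi 0)) (y : ℝ) :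
    IntegrableOn (fun x => ((Real.sign (y - x) : ℝ) : ℂ) / 2 * f x) (Ioi 0) := by
  refine hf.bdd_mul (c := 1) ?_ ?_
  · exact ((Complex.measurable_ofReal.comp (measurable_sign_sub.comp
      measurable_prodMk_left)).div_const 2).aestronglyMeasurable
  · exact Filter.Eventually.of_forall fun z => norm_sign_div_two_le _

lemma skew1_eq (f g : ℂ[X]) : skew1 M N t f g =
    ∫ x in Ioi (0 : ℝ), f.eval (x : ℂ) * wC M N t x *
      epsC (fun y => g.eval (y : ℂ) * wC M N t y) x := by
  unfold skew1 epsC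
  congr 1 with x
  rw [← integral_const_mul]
  congr 1 with y
  ring

lemma skew1_swap (hNM : N < M) (ht : t.im ≠ 0) (f g : ℂ[X]) :
    skew1 M N t f g = -skew1 M N t g f := by
  have hi := integrable_sign_mul_mul (integrableOn_eval_mul_wC hNM ht f)
    (integrableOn_eval_mul_wC hNM ht g)
  have e : skew1 M N t f g = ∫ x in Ioi (0 : ℝ), ∫ y in Ioi (0 : ℝ),
      ((Real.sign (x - y) : ℝ) : ℂ) / 2 *
        (f.eval (x : ℂ) * wC M N t x * (g.eval (y : ℂ) * wC M N t y)) := by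
    unfold skew1
    congr 1 with x
    congr 1 with y
    ring
  rw [e, integral_integral_swap hi, skew1, ← integral_neg]
  congr 1 with x
  rw [← integral_neg]
  congr 1 with y
  rw [← neg_sub x y, Real.sign_neg]
  push_cast
  ring

lemma integrableOn_mul_epsC (hNM : N < M) (ht : t.im ≠ 0) (f g : ℂ[X]) :
    IntegrableOn (fun x : ℝ => f.eval (x : ℂ) * wC M N t x *
      epsC (fun y => g.eval (y : ℂ) * wC M N t y) x) (Ioi 0) := by
  have hi := (integrable_sign_mul_mul (integrableOn_eval_mul_wC hNM ht f)
    (integrableOn_eval_mul_wC hNM ht g)).integral_prod_left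
  refine hi.congr (Filter.Eventually.of_forall fun x => ?_)
  simp only [epsC]
  rw [← integral_const_mul]
  congr 1 with y
  ring

/-- `p ↦ ε(p·w)(y)` as a linear functional on polynomials. -/
noncomputable def epsLin (hNM : N < M) (ht : t.im ≠ 0) (y : ℝ) : ℂ[X] →ₗ[ℂ] ℂ where
  toFun p := epsC (fun x => p.eval (x : ℂ) * wC M N t x) y
  map_add' p q := by
    simp only [epsC, eval_add, add_mul, mul_add]
    exact integral_add (integrableOn_sign_mul (integrableOn_eval_mul_wC hNM ht p) y)
      (integrableOn_sign_mul (integrableOn_eval_mul_wC hNM ht q) y)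
  map_smul' c p := by
    simp only [epsC, eval_smul, smul_eq_mul, RingHom.id_apply]
    rw [← integral_const_mul]
    congr 1 with x
    ring

lemma skew1_add_left (hNM : N < M) (ht : t.im ≠ 0) (f₁ f₂ g : ℂ[X]) :
    skew1 M N t (f₁ + f₂) g = skew1 M N t f₁ g + skew1 M N t f₂ g := by
  simp only [skew1_eq, eval_add, add_mul]
  exact integral_add (integrableOn_mul_epsC hNM ht f₁ g) (integrableOn_mul_epsC hNM ht f₂ g)

lemma skew1_smul_left (c : ℂ) (f g : ℂ[X]) :
    skew1 M N t (c • f) g = c * skew1 M N t f g := by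
  simp only [skew1_eq, eval_smul, smul_eq_mul]
  rw [← integral_const_mul]
  congr 1 with x
  ring

/-- The skew product as a bilinear form. -/
noncomputable def skewForm (hNM : N < M) (ht : t.im ≠ 0) : ℂ[X] →ₗ[ℂ] ℂ[X] →ₗ[ℂ] ℂ :=
  LinearMap.mk₂ ℂ (skew1 M N t) (skew1_add_left hNM ht) skew1_smul_left
    (fun f g₁ g₂ => by
      rw [skew1_swap hNM ht, skew1_add_left hNM ht, skew1_swap hNM ht f, skew1_swap hNM ht f]
      ring)
    (fun c f g => by
      rw [skew1_swap hNM ht, skew1_smul_left, skew1_swap hNM ht f, smul_eq_mul]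
      ring)

lemma inner2C_eq (f g : ℂ[X]) : inner2C M N f g =
    ∫ x in Ioi (0 : ℝ), (f * g).eval (x : ℂ) * (w0R M N x : ℂ) := by
  simp [inner2C]

/-- Integration against the Laguerre weight as a linear functional on polynomials. -/
noncomputable def lagInt (hNM : N < M) : ℂ[X] →ₗ[ℂ] ℂ where
  toFun p := ∫ x in Ioi (0 : ℝ), p.eval (x : ℂ) * (w0R M N x : ℂ)
  map_add' p q := by
    simp only [eval_add, add_mul]
    exact integral_add (integrableOn_eval_mul_w0R hNM p) (integrableOn_eval_mul_w0R hNM q)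
  map_smul' c p := by
    simp only [eval_smul, smul_eq_mul, RingHom.id_apply, mul_assoc]
    rw [← integral_const_mul]

lemma skew1_Tq (hNM : N < M) (ht : t.im ≠ 0) (f q : ℂ[X]) :
    skew1 M N t f (Tq M N t q) = lagInt hNM (f * q) := by
  rw [skew1_eq]
  refine setIntegral_congr_fun measurableSet_Ioi fun x hx => ?_
  simp only [epsC_Tq hNM ht q hx, ← wC_sq hNM ht hx, eval_mul]
  ring

/-- The functional `lagInt` separates polynomials. -/
lemma lagInt_conj_ne_zero (hNM : N < M) {p : ℂ[X]} (hp : p ≠ 0) :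
    lagInt hNM (p * p.map (starRingEnd ℂ)) ≠ 0 := by
  intro h
  have he : ∀ x : ℝ, (p * p.map (starRingEnd ℂ)).eval (x : ℂ) * (w0R M N x : ℂ)
      = ((Complex.normSq (p.eval (x : ℂ)) * w0R M N x : ℝ) : ℂ) := by
    intro x
    have : (p.map (starRingEnd ℂ)).eval (x : ℂ) = (starRingEnd ℂ) (p.eval (x : ℂ)) := by
      conv_lhs => rw [← Complex.conj_ofReal x]
      rw [eval_map_apply]
    rw [eval_mul, this, Complex.mul_conj]
    push_cast
    ring
  have hint := integrableOn_eval_mul_w0R hNM (p * p.map (starRingEnd ℂ))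
  change ∫ x in Ioi (0 : ℝ), _ = _ at h
  simp only [he] at h hint
  rw [integral_complex_ofReal, Complex.ofReal_eq_zero] at h
  have hw : ∀ x ∈ Ioi (0 : ℝ), 0 < w0R M N x := fun x hx => by
    have : (0 : ℝ) < x := hx
    unfold w0R
    positivity
  have hint' : IntegrableOn (fun x : ℝ => Complex.normSq (p.eval (x : ℂ)) * w0R M N x) (Ioi 0) := by
    have := hint.re
    simpa [IntegrableOn] using this
  rw [integral_eq_zero_iff_of_nonneg_ae ?_ hint'] at h
  · have hr : ∀ᵐ x : ℝ ∂(volume.restrict (Ioi 0)), p.eval (x : ℂ) = 0 := by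
      filter_upwards [h, ae_restrict_mem measurableSet_Ioi] with x hx hx0
      simpa [(hw x hx0).ne'] using hx
    have hfin : {x : ℝ | p.eval (x : ℂ) = 0}.Finite := by
      refine Set.Finite.subset (Set.Finite.preimage (f := ((↑) : ℝ → ℂ))
        Complex.ofReal_injective.injOn p.roots.toFinset.finite_toSet) ?_
      intro x hx
      simpa [hp] using hx
    have hz : ∀ᵐ x : ℝ ∂(volume.restrict (Ioi 0)), ¬ p.eval (x : ℂ) = 0 :=
      ae_restrict_of_ae (measure_mono_null (fun x hx => by simpa using hx) (hfin.measure_zero volume))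
    have hf : ∀ᵐ x : ℝ ∂(volume.restrict (Ioi (0 : ℝ))), False := by
      filter_upwards [hr, hz] with x h1 h2 using h2 h1
    rw [ae_iff] at hf
    simp at hf
  · filter_upwards [ae_restrict_mem measurableSet_Ioi] with x hx
    exact mul_nonneg (Complex.normSq_nonneg _) (hw x hx).le

end Forms

section OrthogonalPolynomials

lemma degree_sub_C_mul_lt {q p : ℂ[X]} {n : ℕ} (hq : q.natDegree ≤ n) (hp : p.Monic)
    (hpn : p.natDegree = n) : (q - C (q.coeff n) * p).degree < n := by
  rw [degree_lt_iff_coeff_zero]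
  intro m hm
  rcases hm.eq_or_lt with rfl | hm
  · have : p.coeff n = 1 := by rw [← hpn]; exact hp.coeff_natDegree
    simp [this]
  · simp [coeff_eq_zero_of_natDegree_lt (hq.trans_lt hm),
      coeff_eq_zero_of_natDegree_lt (hpn.trans_lt hm)]

lemma natDegree_X_mul_le_succ (p : ℂ[X]) : (X * p).natDegree ≤ p.natDegree + 1 :=
  natDegree_mul_le.trans (by rw [natDegree_X, add_comm])

lemma natDegree_le_of_degree_lt_succ {q : ℂ[X]} {n : ℕ} (h : q.degree < (n + 1 : ℕ)) :
    q.natDegree ≤ n := by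
  rw [natDegree_le_iff_coeff_eq_zero]
  exact fun m hm => (degree_lt_iff_coeff_zero _ _).1 h m hm

/-- A linear functional vanishing on monic polynomials of every degree `< n` vanishes on all
polynomials of degree `< n`. -/
lemma linearMap_eq_zero_of_degree_lt {s : ℕ → ℂ[X]} {n : ℕ}
    (hs : ∀ j < n, (s j).Monic ∧ (s j).natDegree = j) (φ : ℂ[X] →ₗ[ℂ] ℂ)
    (h : ∀ j < n, φ (s j) = 0) (p : ℂ[X]) (hp : p.degree < n) : φ p = 0 := by
  induction n generalizing p with
  | zero =>
    have : p = 0 := by simpa using hp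
    simp [this]
  | succ n ih =>
    have hd := degree_sub_C_mul_lt (natDegree_le_of_degree_lt_succ hp) (hs n n.lt_succ_self).1
      (hs n n.lt_succ_self).2
    have := ih (fun j hj => hs j (by omega)) (fun j hj => h j (by omega)) _ hd
    rw [map_sub, ← smul_eq_C_mul, map_smul, h n n.lt_succ_self] at this
    simpa using this

/-- `L` is a sequence of monic orthogonal polynomials with nonzero squared norms for the
functional `I`. -/
structure IsMonicOrthogonal (I : ℂ[X] →ₗ[ℂ] ℂ) (L : ℕ → ℂ[X]) : Prop where
  monic : ∀ n, (L n).Monic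
  natDegree : ∀ n, (L n).natDegree = n
  orth : ∀ (n : ℕ) (q : ℂ[X]), q.degree < n → I (L n * q) = 0
  ne_zero : ∀ n, I (L n * L n) ≠ 0

namespace IsMonicOrthogonal

variable {I : ℂ[X] →ₗ[ℂ] ℂ} {L : ℕ → ℂ[X]}

lemma degree_eq (hL : IsMonicOrthogonal I L) (n : ℕ) : (L n).degree = n := by
  rw [degree_eq_natDegree (hL.monic n).ne_zero, hL.natDegree]

lemma coeff_self (hL : IsMonicOrthogonal I L) (n : ℕ) : (L n).coeff n = 1 := by
  have := (hL.monic n).coeff_natDegree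
  rwa [hL.natDegree] at this

lemma coeff_of_lt (hL : IsMonicOrthogonal I L) {n m : ℕ} (h : n < m) : (L n).coeff m = 0 :=
  coeff_eq_zero_of_natDegree_lt ((hL.natDegree n).trans_lt h)

lemma apply_mul (hL : IsMonicOrthogonal I L) {n : ℕ} {q : ℂ[X]} (hq : q.natDegree ≤ n) :
    I (L n * q) = q.coeff n * I (L n * L n) := by
  have := hL.orth n _ (degree_sub_C_mul_lt hq (hL.monic n) (hL.natDegree n))
  rw [mul_sub, map_sub, mul_left_comm, ← smul_eq_C_mul, map_smul, sub_eq_zero] at this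
  exact this

lemma apply_mul_of_ne (hL : IsMonicOrthogonal I L) {i j : ℕ} (h : i ≠ j) : I (L i * L j) = 0 := by
  rcases h.lt_or_gt with h | h
  · rw [mul_comm]
    exact hL.orth j _ (by rw [hL.degree_eq]; exact_mod_cast h)
  · exact hL.orth i _ (by rw [hL.degree_eq]; exact_mod_cast h)

lemma expansion (hL : IsMonicOrthogonal I L) {n : ℕ} {p : ℂ[X]} (hp : p.degree < n) :
    p = ∑ j ∈ Finset.range n, C (I (p * L j) / I (L j * L j)) * L j := by
  induction n generalizing p with
  | zero => simpa using hp
  | succ n ih =>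
    have hd := natDegree_le_of_degree_lt_succ hp
    have h1 := ih (degree_sub_C_mul_lt hd (hL.monic n) (hL.natDegree n))
    rw [Finset.sum_range_succ, mul_comm p (L n), hL.apply_mul hd,
      mul_div_cancel_right₀ _ (hL.ne_zero n), ← sub_eq_iff_eq_add]
    refine h1.trans (Finset.sum_congr rfl fun j hj => ?_)
    have hj : n ≠ j := (Finset.mem_range.1 hj).ne'
    have e : I (C (p.coeff n) * (L n * L j)) = 0 := by
      rw [← smul_eq_C_mul, map_smul, hL.apply_mul_of_ne hj, smul_zero]
    rw [sub_mul, map_sub, mul_assoc, e, sub_zero]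

lemma expansion_of_orth (hL : IsMonicOrthogonal I L) {n : ℕ} {p : ℂ[X]}
    (hp : p.degree < (n + 2 : ℕ)) (h : ∀ j < n, I (p * L j) = 0) :
    p = C (I (p * L n) / I (L n * L n)) * L n +
      C (I (p * L (n + 1)) / I (L (n + 1) * L (n + 1))) * L (n + 1) := by
  have h1 := hL.expansion hp
  rw [Finset.sum_range_succ, Finset.sum_range_succ, Finset.sum_eq_zero, zero_add] at h1
  · exact h1
  · intro j hj
    simp [h j (Finset.mem_range.1 hj)]

lemma degree_X_mul_sub_lt (hL : IsMonicOrthogonal I L) (n : ℕ) :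
    (X * L n - L (n + 1) : ℂ[X]).degree < ((n + 1 : ℕ) : WithBot ℕ) := by
  rw [degree_lt_iff_coeff_zero]
  intro m hm
  obtain ⟨k, rfl⟩ : ∃ k, m = k + 1 := ⟨m - 1, by omega⟩
  rw [coeff_sub, coeff_X_mul]
  rcases hm.eq_or_lt with h | h
  · obtain rfl : n = k := by omega
    simp [hL.coeff_self]
  · rw [hL.coeff_of_lt (by omega), hL.coeff_of_lt h, sub_zero]

/-- The three-term recurrence. -/
lemma recurrence (hL : IsMonicOrthogonal I L) (n : ℕ) :
    ∃ b : ℂ, X * L (n + 1) = L (n + 2) + C b * L (n + 1) +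
      C (I (L (n + 1) * L (n + 1)) / I (L n * L n)) * L n := by
  have h := hL.expansion_of_orth (p := X * L (n + 1) - L (n + 2)) (n := n)
    (hL.degree_X_mul_sub_lt (n + 1)) ?_
  · have e : I ((X * L (n + 1) - L (n + 2)) * L n) = I (L (n + 1) * L (n + 1)) := by
      rw [sub_mul, map_sub, hL.apply_mul_of_ne (by omega), sub_zero, mul_comm X, mul_assoc,
        hL.apply_mul, coeff_X_mul, hL.coeff_self, one_mul]
      exact (natDegree_X_mul_le_succ _).trans (by rw [hL.natDegree])
    rw [e] at h
    exact ⟨I ((X * L (n + 1) - L (n + 2)) * L (n + 1)) / I (L (n + 1) * L (n + 1)),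
      by linear_combination h⟩
  · intro j hj
    rw [sub_mul, map_sub, hL.apply_mul_of_ne (by omega), sub_zero, mul_comm X, mul_assoc]
    refine hL.orth _ _ (degree_lt_degree ?_ |>.trans_eq (hL.degree_eq _))
    refine (natDegree_X_mul_le_succ _).trans_lt ?_
    rw [hL.natDegree, hL.natDegree]
    omega

/-- The Christoffel–Darboux formula. -/
lemma christoffel_darboux (hL : IsMonicOrthogonal I L) (n : ℕ) (x y : ℂ) :
    (x - y) * ∑ j ∈ Finset.range (n + 1), (L j).eval x * (L j).eval y / I (L j * L j) =
      ((L (n + 1)).eval x * (L n).eval y - (L (n + 1)).eval y * (L n).eval x) /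
        I (L n * L n) := by
  induction n with
  | zero =>
    have h0 : L 0 = 1 := (hL.monic 0).natDegree_eq_zero.1 (hL.natDegree 0)
    have h1 : L 1 = X + C ((L 1).coeff 0) := by
      have := (hL.natDegree 1).le
      conv_lhs => rw [eq_X_add_C_of_natDegree_le_one this, hL.coeff_self 1]
      simp
    rw [h1]
    simp [h0]
    ring
  | succ n ih =>
    obtain ⟨b, hb⟩ := hL.recurrence n
    have ex := congrArg (eval x) hb
    have ey := congrArg (eval y) hb
    simp only [eval_mul, eval_add, eval_X, eval_C] at ex ey
    rw [Finset.sum_range_succ, mul_add, ih]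
    have h1 := hL.ne_zero n
    have h2 := hL.ne_zero (n + 1)
    field_simp at ex ey ⊢
    linear_combination (L (n + 1)).eval y * ex - (L (n + 1)).eval x * ey

/-- The difference of subleading coefficients, for a functional annihilating
`X q' + (β - M X) q` for all `q`. -/
lemma mul_coeff_sub_coeff (hL : IsMonicOrthogonal I L) {M β : ℂ}
    (hI : ∀ q : ℂ[X], I (X * derivative q + (C β - C M * X) * q) = 0) (n : ℕ) :
    M * ((L (n + 1)).coeff n - (L (n + 2)).coeff (n + 1)) = 2 * (n + 1) + β := by
  have h1 : I (L (n + 1) * (X * L (n + 1))) =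
      ((L (n + 1)).coeff n - (L (n + 2)).coeff (n + 1)) * I (L (n + 1) * L (n + 1)) := by
    have := hL.apply_mul (n := n + 1)
      (natDegree_le_of_degree_lt_succ (hL.degree_X_mul_sub_lt (n + 1)))
    rw [mul_sub, map_sub, hL.apply_mul_of_ne (by omega), sub_zero, coeff_sub, coeff_X_mul] at this
    exact this
  have h2 : I (L (n + 1) * (X * derivative (L (n + 1)))) =
      (n + 1) * I (L (n + 1) * L (n + 1)) := by
    rw [hL.apply_mul, coeff_X_mul, coeff_derivative, hL.coeff_self, one_mul]
    refine (natDegree_X_mul_le_succ _).trans ?_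
    have := natDegree_derivative_le (L (n + 1))
    rw [hL.natDegree] at this
    omega
  have h3 := hI (L (n + 1) * L (n + 1))
  have e : X * derivative (L (n + 1) * L (n + 1)) + (C β - C M * X) * (L (n + 1) * L (n + 1)) =
      (2 : ℂ) • (L (n + 1) * (X * derivative (L (n + 1)))) + β • (L (n + 1) * L (n + 1))
        - M • (L (n + 1) * (X * L (n + 1))) := by
    simp only [smul_eq_C_mul, derivative_mul, map_ofNat]
    ring
  rw [e, map_sub, map_add, map_smul, map_smul, map_smul, h1, h2] at h3
  simp only [smul_eq_mul] at h3
  refine mul_right_cancel₀ (hL.ne_zero (n + 1)) ?_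
  linear_combination -h3

end IsMonicOrthogonal

end OrthogonalPolynomials

lemma IsLag.isMonicOrthogonal {M N : ℕ} (hNM : N < M) {L : ℕ → ℂ[X]} (hL : IsLag M N L) :
    IsMonicOrthogonal (lagInt hNM) L := by
  have horth : ∀ (n : ℕ) (q : ℂ[X]), q.degree < n → lagInt hNM (L n * q) = 0 := by
    intro n q hq
    refine linearMap_eq_zero_of_degree_lt (s := fun j => X ^ j) (n := n)
      (fun j _ => ⟨monic_X_pow j, natDegree_X_pow j⟩)
      ((lagInt hNM).comp (LinearMap.mulLeft ℂ (L n))) (fun j hj => ?_) q hq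
    exact (inner2C_eq _ _).symm.trans ((hL n).2.2 j hj)
  refine ⟨fun n => (hL n).1, fun n => (hL n).2.1, horth, fun n h => ?_⟩
  refine lagInt_conj_ne_zero hNM (hL n).1.ne_zero ?_
  have hd : ((L n).map (starRingEnd ℂ)).natDegree ≤ n :=
    (natDegree_map_le).trans (hL n).2.1.le
  have := horth n _ (degree_sub_C_mul_lt hd (hL n).1 (hL n).2.1)
  rw [mul_sub, map_sub, mul_left_comm, ← smul_eq_C_mul, map_smul, h] at this
  simpa using this

lemma hC_eq {M N : ℕ} (hNM : N < M) (L : ℕ → ℂ[X]) (n : ℕ) :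
    hC M N L n = lagInt hNM (L n * L n) := by
  simp [hC, lagInt, sq]

lemma coeff_Tq (M N : ℕ) (t : ℂ) (q : ℂ[X]) (k : ℕ) :
    (Tq M N t q).coeff (k + 2) = t * (q.coeff (k + 2) * (k + 2)) - q.coeff (k + 1) * (k + 1)
      + (t + ((M : ℂ) - N - 1) / 2 * t) * q.coeff (k + 2)
      + (-2 - (M : ℂ) / 2 * t - ((M : ℂ) - N - 1) / 2 + 1 / 2) * q.coeff (k + 1)
      + (M : ℂ) / 2 * q.coeff k := by
  have e : Tq M N t q = C t * (X * derivative q) - X * (X * derivative q)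
      + C (t + ((M : ℂ) - N - 1) / 2 * t) * q
      + C (-2 - (M : ℂ) / 2 * t - ((M : ℂ) - N - 1) / 2 + 1 / 2) * (X * q)
      + C ((M : ℂ) / 2) * (X * (X * q)) := by
    simp only [Tq, C_add, C_sub, C_mul, C_neg, map_ofNat]
    ring
  rw [e]
  simp only [coeff_add, coeff_sub, coeff_C_mul, coeff_X_mul, coeff_derivative]
  push_cast
  ring

section GramMatrix

variable {N : ℕ} {r : ℕ → ℂ[X]} {B : ℂ[X] →ₗ[ℂ] ℂ[X] →ₗ[ℂ] ℂ} {D : Matrix (Fin N) (Fin N) ℂ}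

lemma degree_sum_C_mul_lt (hr : ∀ j < N, (r j).Monic ∧ (r j).natDegree = j) (v : Fin N → ℂ) :
    (∑ j : Fin N, C (v j) * r j).degree < N := by
  rw [← mem_degreeLT]
  refine Submodule.sum_mem _ fun j _ => ?_
  rw [mem_degreeLT]
  rw [← smul_eq_C_mul]
  refine (degree_smul_le _ _).trans_lt ?_
  rw [degree_eq_natDegree (hr j j.2).1.ne_zero, (hr j j.2).2]
  exact_mod_cast j.2

lemma eq_zero_of_sum_C_mul_eq_zero (hr : ∀ j < N, (r j).Monic ∧ (r j).natDegree = j)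
    {v : Fin N → ℂ} (h : ∑ j : Fin N, C (v j) * r j = 0) : v = 0 := by
  let S : Polynomial.Sequence ℂ :=
    { elems' := fun j => if j < N then r j else X ^ j
      degree_eq' := fun j => by
        split_ifs with hj
        · rw [degree_eq_natDegree (hr j hj).1.ne_zero, (hr j hj).2]
        · exact degree_X_pow j }
  have hS : ∀ j : Fin N, S j = r j := fun j => if_pos j.2
  have hli := S.linearIndependent.comp (fun j : Fin N => (j : ℕ)) Fin.val_injective
  refine funext (Fintype.linearIndependent_iff.1 hli v ?_)
  simpa [hS, smul_eq_C_mul] using h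

lemma det_ne_zero_of_nondegenerate (hr : ∀ j < N, (r j).Monic ∧ (r j).natDegree = j)
    (hD : ∀ j k : Fin N, D j k = B (r j) (r k))
    (h : ∀ f : ℂ[X], f.degree < N → (∀ g : ℂ[X], g.degree < N → B f g = 0) → f = 0) :
    D.det ≠ 0 := by
  intro h0
  obtain ⟨v, hv, hv0⟩ := Matrix.exists_vecMul_eq_zero_iff.2 h0
  refine hv (eq_zero_of_sum_C_mul_eq_zero hr (h _ (degree_sum_C_mul_lt hr v) fun g hg => ?_))
  refine linearMap_eq_zero_of_degree_lt hr _ (fun k hk => ?_) g hg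
  have := congrFun hv0 ⟨k, hk⟩
  simpa [Matrix.vecMul, dotProduct, hD, ← smul_eq_C_mul] using this

/-- The inverse Gram matrix represents linear functionals on polynomials of degree `< N`. -/
lemma apply_sum_inv_eq (hr : ∀ j < N, (r j).Monic ∧ (r j).natDegree = j)
    (hD : ∀ j k : Fin N, D j k = B (r j) (r k)) (hdet : D.det ≠ 0) (φ : ℂ[X] →ₗ[ℂ] ℂ)
    {g : ℂ[X]} (hg : g.degree < N) :
    B g (∑ j : Fin N, C (∑ k : Fin N, D⁻¹ j k * φ (r k)) * r j) = φ g := by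
  rw [← sub_eq_zero]
  refine linearMap_eq_zero_of_degree_lt hr
    (B.flip (∑ j : Fin N, C (∑ k : Fin N, D⁻¹ j k * φ (r k)) * r j) - φ) (fun i hi => ?_) g hg
  have h1 : D.mulVec (D⁻¹.mulVec fun k : Fin N => φ (r k)) = fun k : Fin N => φ (r k) := by
    rw [Matrix.mulVec_mulVec, Matrix.mul_nonsing_inv _ (Ne.isUnit hdet), Matrix.one_mulVec]
  have h2 := congrFun h1 ⟨i, hi⟩
  simp only [Matrix.mulVec, dotProduct, hD] at h2
  rw [LinearMap.sub_apply, LinearMap.flip_apply, sub_eq_zero, map_sum]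
  refine Eq.trans (Finset.sum_congr rfl fun j _ => ?_) h2
  rw [← smul_eq_C_mul, map_smul, smul_eq_mul, mul_comm]

end GramMatrix

section Kernel

variable {M n : ℕ} {t : ℂ} {L : ℕ → ℂ[X]}

lemma degree_Tq_lt {N : ℕ} {q : ℂ[X]} {m : ℕ} (hq : q.natDegree < m) :
    (Tq M N t q).degree < ((m + 2 : ℕ) : WithBot ℕ) := by
  rw [degree_lt_iff_coeff_zero]
  intro k hk
  obtain ⟨i, rfl⟩ : ∃ i, k = i + 2 := ⟨k - 2, by omega⟩
  rw [coeff_Tq, coeff_eq_zero_of_natDegree_lt (by omega : q.natDegree < i + 2),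
    coeff_eq_zero_of_natDegree_lt (by omega : q.natDegree < i + 1),
    coeff_eq_zero_of_natDegree_lt (by omega : q.natDegree < i)]
  ring

/-- A polynomial of degree `< n + 2` pairing to zero with `T(L_j)`, `j < n`, and with `L_n` and
`L_{n+1}` vanishes. -/
lemma eq_zero_of_skewForm_eq_zero (hNM : n + 2 < M) (ht : t.im ≠ 0)
    (hL : IsMonicOrthogonal (lagInt hNM) L) (hne : skewForm hNM ht (L (n + 1)) (L n) ≠ 0) {f : ℂ[X]}
    (hf : f.degree < ((n + 2 : ℕ) : WithBot ℕ)) (hj : ∀ j < n, lagInt hNM (f * L j) = 0)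
    (h0 : skewForm hNM ht f (L n) = 0) (h1 : skewForm hNM ht f (L (n + 1)) = 0) : f = 0 := by
  have hsw : ∀ a b, skewForm hNM ht a b = -skewForm hNM ht b a := skew1_swap hNM ht
  have hself : ∀ a, skewForm hNM ht a a = 0 := fun a => self_eq_neg.1 (hsw a a)
  have he := hL.expansion_of_orth hf hj
  generalize lagInt hNM (f * L n) / lagInt hNM (L n * L n) = a at he
  generalize lagInt hNM (f * L (n + 1)) / lagInt hNM (L (n + 1) * L (n + 1)) = b at he
  simp only [he, ← smul_eq_C_mul, map_add, map_smul, LinearMap.add_apply, LinearMap.smul_apply,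
    smul_eq_mul, hself, mul_zero, zero_add, add_zero, mul_eq_zero, hne, or_false] at h0 h1
  rw [hsw] at h1
  simp only [neg_eq_zero, hne, or_false] at h1
  rw [he, h0, h1]
  simp

lemma degree_Tq_sub_lt (hNM : n + 2 < M) (hL : IsMonicOrthogonal (lagInt hNM) L)
    {p : ℂ[X]} (hp : p.Monic) (hpd : p.natDegree = n + 2) :
    (Tq M (n + 2) t (L n) - C ((M : ℂ) / 2) * p).degree < ((n + 2 : ℕ) : WithBot ℕ) := by
  have h1 := natDegree_le_of_degree_lt_succ (degree_Tq_lt (M := M) (N := n + 2) (t := t)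
    (show (L n).natDegree < n + 1 by rw [hL.natDegree]; omega))
  have h2 : (Tq M (n + 2) t (L n) - C ((Tq M (n + 2) t (L n)).coeff (n + 2)) * p).degree <
      ((n + 2 : ℕ) : WithBot ℕ) := degree_sub_C_mul_lt h1 hp hpd
  have hc : (Tq M (n + 2) t (L n)).coeff (n + 2) = (M : ℂ) / 2 := by
    rw [coeff_Tq, hL.coeff_self, hL.coeff_of_lt (by omega), hL.coeff_of_lt (by omega)]
    ring
  rwa [hc] at h2

lemma degree_Tq_sub_sub_lt (hNM : n + 2 < M) (hL : IsMonicOrthogonal (lagInt hNM) L)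
    {p p' : ℂ[X]} (hp : p.Monic) (hpd : p.natDegree = n + 2) {a b : ℂ}
    (hp' : p' = L (n + 3) - C a * L (n + 1) + C b * L n) :
    (Tq M (n + 2) t (L (n + 1)) - C ((M : ℂ) / 2) * p'
      - C (((M : ℂ) + (n + 2) - M * t) / 2) * p).degree < ((n + 2 : ℕ) : WithBot ℕ) := by
  have hcp : p.coeff (n + 2) = 1 := by rw [← hpd]; exact hp.coeff_natDegree
  have hI : ∀ q : ℂ[X], lagInt hNM
      (X * derivative q + (C ((M : ℂ) - (n + 2 : ℕ) + 1) - C (M : ℂ) * X) * q) = 0 :=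
    integral_deriv_w0R hNM
  have c1 := hL.mul_coeff_sub_coeff hI n
  have c2 := hL.mul_coeff_sub_coeff hI (n + 1)
  rw [degree_lt_iff_coeff_zero]
  intro k hk
  obtain ⟨i, rfl⟩ : ∃ i, k = i + 2 := ⟨k - 2, by omega⟩
  have hi : n ≤ i := by omega
  simp only [coeff_sub, coeff_C_mul, coeff_Tq, hp', coeff_add]
  rw [hL.coeff_of_lt (by omega : n + 1 < i + 2), hL.coeff_of_lt (by omega : n < i + 2)]
  rcases hi.eq_or_lt with rfl | hi
  · rw [hL.coeff_self, hcp]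
    push_cast at c1 c2 ⊢
    linear_combination (c1 + c2) / 2
  · rw [hL.coeff_of_lt (by omega : n + 1 < i + 1), coeff_eq_zero_of_natDegree_lt
      (by omega : p.natDegree < i + 2)]
    rcases (Nat.succ_le_of_lt hi).eq_or_lt with rfl | hi'
    · rw [hL.coeff_self, show n.succ + 2 = n + 3 from rfl, hL.coeff_self]
      ring
    · rw [hL.coeff_of_lt (by omega), hL.coeff_of_lt (by omega)]
      ring

end Kernel

/-- Assume `N` even, `N ≥ 6`, and
`⟨L_{N−1},L_{N−2}⟩₁·⟨L_{N−3},L_{N−4}⟩₁ ≠ 0`.  With `r_j` arbitrary monic of degree `j`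
for `j ≤ N−3`, `r_{N−2} = π_{N−2,1}`, `r_{N−1} = π_{N−1,1}` (the `c = 0`
normalization), the moment matrix `D` with entries `⟨r_j, r_k⟩₁` is invertible and,
with `μ = D⁻¹` and `S₁(x,y) = −Σ_{j,k} r_j(x)w(x)μ_{jk}ε(r_k w)(y)`, for all distinct
`x, y ∈ (0,∞)` the difference `S₁(x,y) − K₂(x,y)` is the stated rank-two correction
involving `ε(π_{N+1,1}w)` and `ε(π_{N,1}w)`. -/
theorem stmt_11 (M N : ℕ) (hNe : Even N) (hN : 6 ≤ N) (hNM : N < M)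
    (t : ℂ) (ht : t.im ≠ 0)
    (L : ℕ → Polynomial ℂ) (hL : IsLag M N L)
    (hne : skew1 M N t (L (N - 1)) (L (N - 2)) *
        skew1 M N t (L (N - 3)) (L (N - 4)) ≠ 0)
    (r : ℕ → Polynomial ℂ)
    (hrlow : ∀ j, j ≤ N - 3 → (r j).Monic ∧ (r j).natDegree = j)
    (hrN2 : (r (N - 2)).Monic ∧ (r (N - 2)).natDegree = N - 2 ∧
      ∀ j, j < N - 2 → skew1 M N t (r (N - 2)) (Polynomial.X ^ j) = 0)
    (hrN1 : r (N - 1) = L (N - 1)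
      - Polynomial.C (skew1 M N t (L (N - 1)) (L (N - 4)) /
          skew1 M N t (L (N - 3)) (L (N - 4))) * L (N - 3)
      + Polynomial.C (skew1 M N t (L (N - 1)) (L (N - 3)) /
          skew1 M N t (L (N - 3)) (L (N - 4))) * L (N - 4))
    (piN : Polynomial ℂ)
    (hpiN : piN.Monic ∧ piN.natDegree = N ∧
      ∀ j, j < N → skew1 M N t piN (Polynomial.X ^ j) = 0)
    (piN1 : Polynomial ℂ)
    (hpiN1 : piN1 = L (N + 1)
      - Polynomial.C (skew1 M N t (L (N + 1)) (L (N - 2)) /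
          skew1 M N t (L (N - 1)) (L (N - 2))) * L (N - 1)
      + Polynomial.C (skew1 M N t (L (N + 1)) (L (N - 1)) /
          skew1 M N t (L (N - 1)) (L (N - 2))) * L (N - 2))
    (D : Matrix (Fin N) (Fin N) ℂ)
    (hD : ∀ j k : Fin N, D j k = skew1 M N t (r j) (r k)) :
    D.det ≠ 0 ∧
    ∀ x ∈ Ioi (0 : ℝ), ∀ y ∈ Ioi (0 : ℝ), x ≠ y →
      (-(∑ j : Fin N, ∑ k : Fin N,
            (r (j : ℕ)).eval (x : ℂ) * wC M N t x * D⁻¹ j k *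
              epsC (fun y' => (r (k : ℕ)).eval (y' : ℂ) * wC M N t y') y))
        - wC M N t x * wC M N t y * (y : ℂ) * (t - (y : ℂ)) *
            ((L N).eval (x : ℂ) * (L (N - 1)).eval (y : ℂ)
              - (L N).eval (y : ℂ) * (L (N - 1)).eval (x : ℂ)) /
            (hC M N L (N - 1) * ((x : ℂ) - (y : ℂ)))
      = epsC (fun y' => piN1.eval (y' : ℂ) * wC M N t y') y *
            (-(M : ℂ) / (2 * hC M N L (N - 1))) * (L (N - 1)).eval (x : ℂ) * wC M N t x
        + epsC (fun y' => piN.eval (y' : ℂ) * wC M N t y') y *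
            ((-(M : ℂ) / (2 * hC M N L (N - 2))) * (L (N - 2)).eval (x : ℂ)
              + ((M : ℂ) * t - ((M : ℂ) + (N : ℂ))) / (2 * hC M N L (N - 1)) *
                  (L (N - 1)).eval (x : ℂ)) * wC M N t x := by
  obtain ⟨n, rfl⟩ : ∃ n, N = n + 2 := ⟨N - 2, by omega⟩
  simp only [show n + 2 - 1 = n + 1 from rfl, show n + 2 - 2 = n from rfl,
    show n + 2 + 1 = n + 3 from rfl] at *
  have hO := hL.isMonicOrthogonal hNM
  set B := skewForm hNM ht with hB
  have hBs : ∀ f g, skew1 M (n + 2) t f g = B f g := fun _ _ => rfl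
  have hsw : ∀ f g, B f g = -B g f := skew1_swap hNM ht
  have hBT : ∀ f q, B f (Tq M (n + 2) t q) = lagInt hNM (f * q) := skew1_Tq hNM ht
  have hself : ∀ a, B a a = 0 := fun a => self_eq_neg.1 (hsw a a)
  simp only [hBs] at *
  have hne' : B (L (n + 1)) (L n) ≠ 0 := left_ne_zero_of_mul hne
  have hr : ∀ j < n + 2, (r j).Monic ∧ (r j).natDegree = j := by
    intro j hj
    rcases (by omega : j ≤ n + 2 - 3 ∨ j = n ∨ j = n + 1) with h | rfl | rfl
    · exact hrlow j h
    · exact ⟨hrN2.1, hrN2.2.1⟩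
    · have hd : (r (n + 1) - L (n + 1)).degree < (L (n + 1)).degree := by
        rw [hO.degree_eq, degree_lt_iff_coeff_zero]
        intro m hm
        rw [hrN1]
        have h1 := hO.coeff_of_lt (by omega : n + 2 - 3 < m)
        have h2 := hO.coeff_of_lt (by omega : n + 2 - 4 < m)
        simp only [coeff_sub, coeff_add, coeff_C_mul, h1, h2]
        ring
      have e : r (n + 1) = L (n + 1) + (r (n + 1) - L (n + 1)) := by ring
      rw [e]
      exact ⟨(hO.monic _).add_of_left hd, by
        rw [natDegree_add_eq_left_of_degree_lt hd, hO.natDegree]⟩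
  have hLd : ∀ {j m : ℕ}, j < m → (L j).degree < m := fun h => by
    rw [hO.degree_eq]; exact_mod_cast h
  have hdet : D.det ≠ 0 := by
    refine det_ne_zero_of_nondegenerate hr hD fun f hf h => ?_
    refine eq_zero_of_skewForm_eq_zero hNM ht hO hne' hf (fun j hj => ?_)
      (h _ (hLd (by omega))) (h _ (hLd (by omega)))
    rw [← hBT]
    exact h _ (degree_Tq_lt (by rwa [hO.natDegree]))
  refine ⟨hdet, fun x _ y hy hxy => ?_⟩
  -- both skew-orthogonal polynomials annihilate all polynomials of degree `< n + 2`
  have hpiN0 : ∀ g : ℂ[X], g.degree < ((n + 2 : ℕ) : WithBot ℕ) → B g piN = 0 := by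
    intro g hg
    rw [hsw, neg_eq_zero]
    exact linearMap_eq_zero_of_degree_lt (s := fun j => X ^ j)
      (fun j _ => ⟨monic_X_pow j, natDegree_X_pow j⟩) (B piN) hpiN.2.2 g hg
  have hpiN10 : ∀ g : ℂ[X], g.degree < ((n + 2 : ℕ) : WithBot ℕ) → B g piN1 = 0 := by
    have hrep := fun {g : ℂ[X]} hg => apply_sum_inv_eq hr hD hdet (B.flip piN1) (g := g) hg
    have hdeg := degree_sum_C_mul_lt hr fun j : Fin (n + 2) =>
      ∑ k : Fin (n + 2), D⁻¹ j k * (B.flip piN1) (r k)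
    set f := ∑ j : Fin (n + 2), C (∑ k : Fin (n + 2), D⁻¹ j k * (B.flip piN1) (r k)) * r j
    simp only [LinearMap.flip_apply] at hrep
    have hf : f = 0 := by
      refine eq_zero_of_skewForm_eq_zero hNM ht hO hne' hdeg (fun j hj => ?_) ?_ ?_
      · rw [← hBT, hsw, hrep (degree_Tq_lt (by rwa [hO.natDegree])), ← hsw, hBT, hpiN1, add_mul,
          sub_mul, mul_assoc, mul_assoc, ← smul_eq_C_mul, ← smul_eq_C_mul]
        simp [hO.apply_mul_of_ne (by omega : n + 3 ≠ j),
          hO.apply_mul_of_ne (by omega : n + 1 ≠ j), hO.apply_mul_of_ne (by omega : n ≠ j)]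
      · rw [← hB, hsw, hrep (hLd (by omega)), ← hsw, hpiN1]
        simp only [← smul_eq_C_mul, map_add, map_sub, map_smul, LinearMap.add_apply,
          LinearMap.sub_apply, LinearMap.smul_apply, hself, smul_eq_mul]
        field_simp
        ring
      · rw [← hB, hsw, hrep (hLd (by omega)), ← hsw, hpiN1]
        simp only [← smul_eq_C_mul, map_add, map_sub, map_smul, LinearMap.add_apply,
          LinearMap.sub_apply, LinearMap.smul_apply, hself, smul_eq_mul, hsw (L n) (L (n + 1))]
        field_simp
        ring
    intro g hg
    rw [← hrep hg, hf, map_zero]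
  set E := epsLin hNM ht y with hE
  have hEs : ∀ p : ℂ[X], epsC (fun y' => p.eval (y' : ℂ) * wC M (n + 2) t y') y = E p :=
    fun _ => rfl
  have hET : ∀ q : ℂ[X], E (Tq M (n + 2) t q) =
      q.eval (y : ℂ) * (y * (t - y)) * wC M (n + 2) t y := fun q => epsC_Tq hNM ht q hy
  simp only [hEs, hC_eq hNM]
  have hrep := fun {g : ℂ[X]} hg => apply_sum_inv_eq hr hD hdet (-E) (g := g) hg
  have hdeg := degree_sum_C_mul_lt hr fun j : Fin (n + 2) =>
    ∑ k : Fin (n + 2), D⁻¹ j k * (-E) (r k)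
  have hsum : -(∑ j : Fin (n + 2), ∑ k : Fin (n + 2),
      (r j).eval (x : ℂ) * wC M (n + 2) t x * D⁻¹ j k * E (r k)) =
      wC M (n + 2) t x * (∑ j : Fin (n + 2),
        C (∑ k : Fin (n + 2), D⁻¹ j k * (-E) (r k)) * r j).eval (x : ℂ) := by
    rw [eval_finsetSum, Finset.mul_sum, ← Finset.sum_neg_distrib]
    refine Finset.sum_congr rfl fun j _ => ?_
    rw [eval_mul, eval_C, Finset.sum_mul, Finset.mul_sum, ← Finset.sum_neg_distrib]
    refine Finset.sum_congr rfl fun k _ => ?_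
    rw [LinearMap.neg_apply]
    ring
  rw [hsum]
  set P := ∑ j : Fin (n + 2), C (∑ k : Fin (n + 2), D⁻¹ j k * (-E) (r k)) * r j
  simp only [LinearMap.neg_apply] at hrep
  have hPlow : ∀ j < n, lagInt hNM (P * L j) =
      (L j).eval (y : ℂ) * (y * (t - y)) * wC M (n + 2) t y := fun j hj => by
    rw [← hBT, hsw, hrep (degree_Tq_lt (by rwa [hO.natDegree])), neg_neg, hET]
  have hPn : lagInt hNM (P * L n) =
      (L n).eval (y : ℂ) * (y * (t - y)) * wC M (n + 2) t y - M / 2 * E piN := by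
    have h1 := hrep (degree_Tq_sub_lt (t := t) hNM hO hpiN.1 hpiN.2.1)
    have h2 : B piN P = 0 := by rw [hsw, hpiN0 _ hdeg, neg_zero]
    rw [← hBT, hsw]
    simp only [← smul_eq_C_mul, map_sub, map_smul, LinearMap.sub_apply, LinearMap.smul_apply,
      h2, smul_eq_mul, hET] at h1
    linear_combination -h1
  have hPn1 : lagInt hNM (P * L (n + 1)) =
      (L (n + 1)).eval (y : ℂ) * (y * (t - y)) * wC M (n + 2) t y - M / 2 * E piN1
        - ((M : ℂ) + (n + 2) - M * t) / 2 * E piN := by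
    have h1 := hrep (degree_Tq_sub_sub_lt (t := t) hNM hO hpiN.1 hpiN.2.1 hpiN1)
    have h2 : B piN P = 0 := by rw [hsw, hpiN0 _ hdeg, neg_zero]
    have h3 : B piN1 P = 0 := by rw [hsw, hpiN10 _ hdeg, neg_zero]
    rw [← hBT, hsw]
    simp only [← smul_eq_C_mul, map_sub, map_smul, LinearMap.sub_apply, LinearMap.smul_apply,
      h2, h3, smul_eq_mul, hET] at h1
    linear_combination -h1
  have hxy' : (x : ℂ) - y ≠ 0 := sub_ne_zero.2 (by exact_mod_cast hxy)
  have hcd := hO.christoffel_darboux (n + 1) x y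
  replace hcd := eq_div_of_mul_eq hxy' ((mul_comm _ _).trans hcd)
  rw [Finset.sum_range_succ, Finset.sum_range_succ] at hcd
  have hPe : P.eval (x : ℂ) = (y * (t - y)) * wC M (n + 2) t y *
        (∑ j ∈ Finset.range n, (L j).eval (x : ℂ) * (L j).eval (y : ℂ) / lagInt hNM (L j * L j))
      + lagInt hNM (P * L n) / lagInt hNM (L n * L n) * (L n).eval (x : ℂ)
      + lagInt hNM (P * L (n + 1)) / lagInt hNM (L (n + 1) * L (n + 1)) *
        (L (n + 1)).eval (x : ℂ) := by
    conv_lhs => rw [hO.expansion hdeg]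
    rw [Finset.sum_range_succ, Finset.sum_range_succ, eval_add, eval_add, eval_finsetSum,
      Finset.mul_sum]
    simp only [eval_mul, eval_C]
    congr 2
    refine Finset.sum_congr rfl fun j hj => ?_
    rw [hPlow j (Finset.mem_range.1 hj)]
    ring
  rw [eq_sub_of_add_eq (eq_sub_of_add_eq hcd), hPn, hPn1] at hPe
  rw [hPe]
  have hh0 := hO.ne_zero n
  have hh1 := hO.ne_zero (n + 1)
  push_cast
  field_simp
  ring
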